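/- The topological support of the unique stationary measure m_{τ,ε} of the noisy Arnol'd circle map family is either the entire circle ℝ/ℤ, or a union of q mutually disjoint nondegenerate closed arcs for some positive integer q. -/

import Mathlib

open MeasureTheory Real Filter Set Function

noncomputable section

lemma sin2_periodic : Function.Periodic (fun x : ℝ => Real.sin (2 * π * x)) 1 := by
  intro x
  simp only [mul_add, mul_one]
  exact Real.sin_add_two_pi _

/-- `sin (2πx)` viewed as a function on the circle `ℝ/ℤ`. -/
def sinA : AddCircle (1:ℝ) → ℝ := sin2_periodic.lift

/-- The noisy Arnol'd circle map `F_w(x) = x + τ + σ w − ε sin (2πx)  (mod 1)`. -/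
def Fmap (τ ε σ w : ℝ) : AddCircle (1:ℝ) → AddCircle (1:ℝ) :=
  fun x => x + (↑(τ + σ * w - ε * sinA x) : AddCircle (1:ℝ))

/-- The uniform probability measure on `I = [−1/2, 1/2]`. -/
def nuI : Measure ℝ := volume.restrict (Icc (-(1/2) : ℝ) (1/2))

/-- A Borel probability measure `m` on the circle is stationary for the noisy circle-map
family when `∫_I (F_w)_* m dν(w) = m`. -/
def IsStationaryMeasure (τ ε σ : ℝ) (m : Measure (AddCircle (1:ℝ))) : Prop :=
  nuI.bind (fun w => m.map (Fmap τ ε σ w)) = m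

/-- The topological support of a measure: points all of whose open neighborhoods have
positive measure. -/
def measSupport (m : Measure (AddCircle (1:ℝ))) : Set (AddCircle (1:ℝ)) :=
  {x | ∀ U : Set (AddCircle (1:ℝ)), IsOpen U → x ∈ U → 0 < m U}

/-- The closed arc of the circle `ℝ/ℤ` obtained by projecting the interval `[a,b]`. -/
def arc (a b : ℝ) : Set (AddCircle (1:ℝ)) :=
  (fun r : ℝ => (r : AddCircle (1:ℝ))) '' Icc a b

lemma continuous_sinA : Continuous sinA :=
  continuous_coinduced_dom.mpr (by
    change Continuous fun x : ℝ => Real.sin (2 * π * x)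
    fun_prop)

lemma continuous_uncurry_Fmap (τ ε σ : ℝ) :
    Continuous fun p : ℝ × AddCircle (1:ℝ) => Fmap τ ε σ p.1 p.2 := by
  have h := continuous_sinA
  have hc : Continuous ((↑) : ℝ → AddCircle (1:ℝ)) := AddCircle.continuous_mk' 1
  exact continuous_snd.add (hc.comp (by fun_prop))

lemma Fmap_add (τ ε σ w s : ℝ) (x : AddCircle (1:ℝ)) :
    Fmap τ ε σ (w + s) x = Fmap τ ε σ w x + ((σ * s : ℝ) : AddCircle (1:ℝ)) := by
  rw [Fmap, Fmap, add_assoc, ← AddCircle.coe_add]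
  congr 2
  ring

lemma measSupport_eq_support (m : Measure (AddCircle (1:ℝ))) : measSupport m = m.support := by
  rw [Measure.support_eq_forall_isOpen]
  ext x
  exact ⟨fun h U hx hU => h U hU hx, fun h U hU hx => h U hx hU⟩

instance isFiniteMeasure_nuI : IsFiniteMeasure nuI :=
  inferInstanceAs (IsFiniteMeasure (volume.restrict (Icc (-(1/2) : ℝ) (1/2))))

/-- A stationary measure is the law of `F_w(x)` for independent `w ~ nuI` and `x ~ m`. -/
lemma IsStationaryMeasure.apply_eq_prod {τ ε σ : ℝ} {m : Measure (AddCircle (1:ℝ))}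
    [IsFiniteMeasure m] (h : IsStationaryMeasure τ ε σ m) {s : Set (AddCircle (1:ℝ))}
    (hs : MeasurableSet s) :
    m s = (nuI.prod m) ((fun p : ℝ × AddCircle (1:ℝ) => Fmap τ ε σ p.1 p.2) ⁻¹' s) := by
  have hF := (continuous_uncurry_Fmap τ ε σ).measurable
  have hw (w : ℝ) : Measurable (Fmap τ ε σ w) := hF.comp measurable_prodMk_left
  have hmeas : Measurable fun w => m.map (Fmap τ ε σ w) := by
    refine Measure.measurable_of_measurable_coe _ fun t ht => ?_
    simp_rw [Measure.map_apply (hw _) ht]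
    exact measurable_measure_prodMk_left (hF ht)
  conv_lhs => rw [← h]
  rw [Measure.bind_apply hs hmeas.aemeasurable, Measure.prod_apply (hF hs)]
  exact lintegral_congr fun w => Measure.map_apply (hw w) hs

lemma IsStationaryMeasure.exists_preimage_of_mem_support {τ ε σ : ℝ}
    {m : Measure (AddCircle (1:ℝ))} [IsFiniteMeasure m] (h : IsStationaryMeasure τ ε σ m)
    {y : AddCircle (1:ℝ)} (hy : y ∈ m.support) :
    ∃ w ∈ Icc (-(1/2) : ℝ) (1/2), ∃ x ∈ m.support, Fmap τ ε σ w x = y := by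
  have hK : IsClosed ((fun p : ℝ × AddCircle (1:ℝ) => Fmap τ ε σ p.1 p.2) ''
      (Icc (-(1/2) : ℝ) (1/2) ×ˢ m.support)) :=
    ((isCompact_Icc.prod Measure.isClosed_support.isCompact).image
      (continuous_uncurry_Fmap τ ε σ)).isClosed
  obtain ⟨⟨w, x⟩, ⟨hw, hx⟩, rfl⟩ := Measure.support_subset_of_isClosed hK (by
    rw [mem_ae_iff, h.apply_eq_prod hK.isOpen_compl.measurableSet]
    have hnu : nuI (Icc (-(1/2) : ℝ) (1/2))ᶜ = 0 := by
      rw [nuI, Measure.restrict_apply measurableSet_Icc.compl, compl_inter_self, measure_empty]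
    have h₁ : (nuI.prod m) ((Icc (-(1/2) : ℝ) (1/2))ᶜ ×ˢ univ) = 0 := by
      rw [Measure.prod_prod, hnu, zero_mul]
    have h₂ : (nuI.prod m) (univ ×ˢ m.supportᶜ) = 0 := by
      rw [Measure.prod_prod, Measure.measure_compl_support, mul_zero]
    refine measure_mono_null (fun p hp => ?_) (measure_union_null h₁ h₂)
    by_contra hcon
    simp only [mem_union, mem_prod, mem_compl_iff, mem_univ, and_true, true_and, not_or,
      not_not] at hcon
    exact hp ⟨p, hcon, rfl⟩) hy
  exact ⟨w, hw, x, hx, rfl⟩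

lemma IsStationaryMeasure.Fmap_mem_support {τ ε σ : ℝ}
    {m : Measure (AddCircle (1:ℝ))} [IsFiniteMeasure m] (h : IsStationaryMeasure τ ε σ m)
    {w : ℝ} (hw : w ∈ Icc (-(1/2) : ℝ) (1/2)) {x : AddCircle (1:ℝ)} (hx : x ∈ m.support) :
    Fmap τ ε σ w x ∈ m.support := by
  rw [(nhds_basis_opens _).mem_measureSupport]
  rintro U ⟨hyU, hU⟩
  rw [h.apply_eq_prod hU.measurableSet]
  obtain ⟨W, V, hW, hV, hwW, hxV, hWV⟩ := isOpen_prod_iff.mp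
    (hU.preimage (continuous_uncurry_Fmap τ ε σ)) w x hyU
  refine lt_of_lt_of_le ?_ (measure_mono hWV)
  rw [Measure.prod_prod]
  refine ENNReal.mul_pos ?_ ((Measure.mem_support_iff_forall x).mp hx V (hV.mem_nhds hxV)).ne'
  rw [nuI, Measure.restrict_apply hW.measurableSet]
  have hcl : w ∈ closure (Ioo (-(1/2) : ℝ) (1/2)) := by
    rwa [closure_Ioo (by norm_num)]
  refine (lt_of_lt_of_le ((hW.inter isOpen_Ioo).measure_pos volume
    (_root_.mem_closure_iff.mp hcl W hW hwW)) (measure_mono ?_)).ne'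
  exact inter_subset_inter_right _ Ioo_subset_Icc_self

/-- Every point of the support lies in an arc of length `σ` contained in the support. -/
lemma IsStationaryMeasure.exists_Icc_subset_support {τ ε σ : ℝ} (hσ : 0 < σ)
    {m : Measure (AddCircle (1:ℝ))} [IsFiniteMeasure m] (h : IsStationaryMeasure τ ε σ m)
    {y : ℝ} (hy : (y : AddCircle (1:ℝ)) ∈ m.support) :
    ∃ c, y ∈ Icc c (c + σ) ∧ ∀ r ∈ Icc c (c + σ), (r : AddCircle (1:ℝ)) ∈ m.support := by
  obtain ⟨w, hw, x, hx, hxy⟩ := h.exists_preimage_of_mem_support hy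
  refine ⟨y - σ * w - σ / 2, ⟨?_, ?_⟩, fun r hr => ?_⟩
  · nlinarith [hw.1]
  · nlinarith [hw.2]
  · have hr' : (r : AddCircle (1:ℝ)) = Fmap τ ε σ (w + (r - y) / σ) x := by
      rw [Fmap_add, hxy, mul_div_cancel₀ _ hσ.ne', ← AddCircle.coe_add, add_sub_cancel]
    rw [hr']
    refine h.Fmap_mem_support ?_ hx
    have hq : (r - y) / σ * σ = r - y := div_mul_cancel₀ _ hσ.ne'
    constructor
    · nlinarith [hr.1]
    · nlinarith [hr.2]

/-- A compact set of reals all of whose points lie in a subinterval of fixed length `σ` is a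
finite disjoint union of nondegenerate closed intervals. -/
lemma IsCompact.exists_eq_iUnion_Icc {K : Set ℝ} (hK : IsCompact K) {σ : ℝ} (hσ : 0 < σ)
    (h : ∀ y ∈ K, ∃ c, y ∈ Icc c (c + σ) ∧ Icc c (c + σ) ⊆ K) :
    ∃ (q : ℕ) (a b : Fin q → ℝ), (∀ i, a i < b i) ∧
      (∀ i j, i ≠ j → Disjoint (Icc (a i) (b i)) (Icc (a j) (b j))) ∧
      K = ⋃ i, Icc (a i) (b i) := by
  set comps : Set (Set ℝ) := connectedComponentIn K '' K with hcomps
  have hsub {y c : ℝ} (hy : y ∈ Icc c (c + σ)) (hc : Icc c (c + σ) ⊆ K) :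
      Icc c (c + σ) ⊆ connectedComponentIn K y :=
    isPreconnected_Icc.subset_connectedComponentIn hy hc
  have hfin : comps.Finite := by
    have hZ : {k : ℤ | (k : ℝ) * σ ∈ K}.Finite := by
      obtain ⟨R, hR⟩ := hK.isBounded.subset_closedBall 0
      refine (Set.finite_Icc (-⌈R / σ⌉) ⌈R / σ⌉).subset fun k hk => ?_
      have hk' := hR hk
      rw [mem_closedBall_zero_iff, Real.norm_eq_abs, abs_le] at hk'
      have hRc := Int.le_ceil (R / σ)
      have h₁ : (k : ℝ) ≤ R / σ := (le_div_iff₀ hσ).mpr hk'.2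
      have h₂ : -(k : ℝ) ≤ R / σ := (le_div_iff₀ hσ).mpr (by linarith [hk'.1])
      constructor
      · exact_mod_cast (by linarith : -(⌈R / σ⌉ : ℝ) ≤ k)
      · exact_mod_cast (by linarith : (k : ℝ) ≤ ⌈R / σ⌉)
    refine (hZ.image fun k : ℤ => connectedComponentIn K (k * σ)).subset ?_
    rintro _ ⟨y, hy, rfl⟩
    obtain ⟨c, hyc, hc⟩ := h y hy
    have hmem : (⌈c / σ⌉ : ℝ) * σ ∈ Icc c (c + σ) := by
      constructor
      · exact (div_le_iff₀ hσ).mp (Int.le_ceil _)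
      · have := Int.ceil_lt_add_one (c / σ)
        have hq : c / σ * σ = c := div_mul_cancel₀ _ hσ.ne'
        nlinarith
    exact ⟨⌈c / σ⌉, hc hmem, (connectedComponentIn_eq (hsub hyc hc hmem)).symm⟩
  have hIcc : ∀ C : comps, ∃ a b : ℝ, a < b ∧ (C : Set ℝ) = Icc a b := by
    rintro ⟨_, y, hy, rfl⟩
    have hconn : IsConnected (connectedComponentIn K y) :=
      isConnected_connectedComponentIn_iff.mpr hy
    have hclosed : IsClosed (connectedComponentIn K y) := by
      refine isClosed_of_closure_subset ?_
      exact hconn.isPreconnected.closure.subset_connectedComponentIn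
        (subset_closure (mem_connectedComponentIn hy))
        (closure_minimal (connectedComponentIn_subset K y) hK.isClosed)
    have heq := eq_Icc_of_connected_compact hconn
      (hK.of_isClosed_subset hclosed (connectedComponentIn_subset K y))
    refine ⟨_, _, ?_, heq⟩
    obtain ⟨c, hyc, hc⟩ := h y hy
    have hs := hsub hyc hc
    rw [heq] at hs
    have h₁ := (hs (left_mem_Icc.mpr (by linarith))).1
    have h₂ := (hs (right_mem_Icc.mpr (by linarith))).2
    linarith
  choose a b hab hCab using hIcc
  have := hfin.to_subtype
  let e := (Finite.equivFin comps).symm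
  refine ⟨Nat.card comps, a ∘ e, b ∘ e, fun i => hab _, fun i j hij => ?_, ?_⟩
  · simp only [Function.comp_apply, ← hCab]
    rw [Set.disjoint_left]
    intro z hzi hzj
    refine hij (e.injective (Subtype.ext ?_))
    obtain ⟨y, -, hyi⟩ := (e i).2
    obtain ⟨y', -, hyj⟩ := (e j).2
    rw [← hyi] at hzi ⊢
    rw [← hyj] at hzj ⊢
    rw [connectedComponentIn_eq hzi, connectedComponentIn_eq hzj]
  · simp only [Function.comp_apply, ← hCab]
    ext y
    rw [mem_iUnion]
    constructor
    · intro hy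
      exact ⟨e.symm ⟨_, y, hy, rfl⟩, by
        rw [Equiv.apply_symm_apply]
        exact mem_connectedComponentIn hy⟩
    · rintro ⟨i, hi⟩
      obtain ⟨z, -, hz⟩ := (e i).2
      rw [← hz] at hi
      exact connectedComponentIn_subset K z hi

/-- A closed nonempty proper subset of the circle all of whose points lie in a sub-arc of fixed
length `σ` is a finite disjoint union of nondegenerate closed arcs. -/
lemma IsClosed.exists_eq_iUnion_arc {S : Set (AddCircle (1:ℝ))} (hS : IsClosed S)
    (hne : S.Nonempty) (huniv : S ≠ univ) {σ : ℝ} (hσ : 0 < σ)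
    (h : ∀ y : ℝ, (y : AddCircle (1:ℝ)) ∈ S →
      ∃ c, y ∈ Icc c (c + σ) ∧ ∀ r ∈ Icc c (c + σ), (r : AddCircle (1:ℝ)) ∈ S) :
    ∃ (q : ℕ) (_ : 0 < q) (a b : Fin q → ℝ),
      (∀ i, a i < b i ∧ b i - a i < 1) ∧
      (∀ i j, i ≠ j → Disjoint (arc (a i) (b i)) (arc (a j) (b j))) ∧
      S = ⋃ i, arc (a i) (b i) := by
  obtain ⟨t', ht'⟩ := (ne_univ_iff_exists_notMem S).mp huniv
  obtain ⟨t, rfl⟩ := QuotientAddGroup.mk_surjective t'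
  change (t : AddCircle (1:ℝ)) ∉ S at ht'
  have ht1 : ((t + 1 : ℝ) : AddCircle (1:ℝ)) ∉ S := by rwa [AddCircle.coe_add_period]
  set K : Set ℝ := Icc t (t + 1) ∩ (↑) ⁻¹' S with hKdef
  have hK : IsCompact K :=
    isCompact_Icc.inter_right (hS.preimage (AddCircle.continuous_mk' 1))
  have hKS : (fun r : ℝ => (r : AddCircle (1:ℝ))) '' K = S := by
    rw [hKdef, image_inter_preimage, AddCircle.coe_image_Icc_eq, univ_inter]
  have hKIoo : K ⊆ Ioo t (t + 1) := by
    rintro y ⟨hy, hyS⟩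
    refine ⟨hy.1.lt_of_ne ?_, hy.2.lt_of_ne ?_⟩
    · rintro rfl
      exact ht' hyS
    · rintro rfl
      exact ht1 hyS
  obtain ⟨q, a, b, hab, hdisj, hU⟩ := hK.exists_eq_iUnion_Icc hσ (by
    intro y hy
    obtain ⟨c, hyc, hc⟩ := h y hy.2
    refine ⟨c, hyc, fun r hr => ⟨⟨?_, ?_⟩, hc r hr⟩⟩
    · by_contra! hlt
      exact ht' (hc t ⟨hr.1.trans hlt.le, hy.1.1.trans hyc.2⟩)
    · by_contra! hlt
      exact ht1 (hc (t + 1) ⟨hyc.1.trans hy.1.2, hlt.le.trans hr.2⟩))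
  have hsubK (i : Fin q) : Icc (a i) (b i) ⊆ K := hU ▸ subset_iUnion_of_subset i Subset.rfl
  refine ⟨q, ?_, a, b, fun i => ⟨hab i, ?_⟩, fun i j hij => ?_, ?_⟩
  · obtain ⟨y, hy⟩ := (hKS ▸ hne).of_image
    rw [hU, mem_iUnion] at hy
    exact hy.choose.pos
  · have h₁ := hKIoo (hsubK i (left_mem_Icc.mpr (hab i).le))
    have h₂ := hKIoo (hsubK i (right_mem_Icc.mpr (hab i).le))
    linarith [h₁.1, h₂.2]
  · rw [Set.disjoint_left]
    rintro _ ⟨x, hx, rfl⟩ ⟨y, hy, hyx⟩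
    have hxy : y = x := (AddCircle.coe_eq_coe_iff_of_mem_Ico
      (Ioo_subset_Ico_self (hKIoo (hsubK j hy)))
      (Ioo_subset_Ico_self (hKIoo (hsubK i hx)))).mp hyx
    exact Set.disjoint_left.mp (hdisj i j hij) hx (hxy ▸ hy)
  · rw [← hKS, hU, image_iUnion]
    rfl

/-- **Structure of the support of the stationary measure:** the support of the unique
stationary measure of the noisy Arnol'd circle-map family is either the whole circle, or
the union of `q` mutually disjoint nondegenerate closed arcs for some `q ≥ 1`. -/
theorem noisy_circle_map_support_structure (τ ε σ : ℝ)
    (hε : 0 < ε) (hεπ : 2 * π * ε < 1) (hσ : 0 < σ)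
    (m : Measure (AddCircle (1:ℝ)))
    (hprob : IsProbabilityMeasure m) (hstat : IsStationaryMeasure τ ε σ m) :
    measSupport m = Set.univ ∨
      ∃ (q : ℕ) (_ : 0 < q) (a b : Fin q → ℝ),
        (∀ i, a i < b i ∧ b i - a i < 1) ∧
        (∀ i j, i ≠ j → Disjoint (arc (a i) (b i)) (arc (a j) (b j))) ∧
        measSupport m = ⋃ i, arc (a i) (b i) := by
  rw [measSupport_eq_support]
  by_cases huniv : m.support = univ
  · exact Or.inl huniv
  · exact Or.inr (Measure.isClosed_support.exists_eq_iUnion_arc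
      (Measure.nonempty_support (IsProbabilityMeasure.ne_zero m)) huniv hσ
      fun _ hy => hstat.exists_Icc_subset_support hσ hy)
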